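/- arXiv:2002.12107 — 4 statements merged into one kernel-verified Lean document; each statement's English description precedes it below -/
import Mathlib

section
/- If α and β are positive reals with αβ = π² and w > 0 is such that √(wα) is not an integer multiple of π and w ≠ n²β for all positive integers n, then (π/2) cot(√(wα)) coth(√(wβ)) = 1/(2w) + (1/2) log(β/α) + Σ_{n=1}^∞ { nα coth(nα)/(w + n²α) + nβ coth(nβ)/(w - n²β) }. -/
open Real

/-- Hyperbolic cotangent. -/
noncomputable def coth (x : ℝ) : ℝ := Real.cosh x / Real.sinh x

lemma cc_congr {R : Type*} [AddCommMonoid R] [TopologicalSpace R] {f g : ℕ → R} {x y : R}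
    (h : HasSum f x) (hfg : ∀ n, g n = f n) (hxy : y = x) : HasSum g y := by
  rw [show g = f from funext hfg, hxy]; exact h

lemma cc_complex (z : ℂ) (hz : z ∈ Complex.integerComplement) :
    HasSum (fun n : ℕ => 1 / (z ^ 2 - ((n : ℂ) + 1) ^ 2))
      ((π * Complex.cot (π * z) / z - 1 / z ^ 2) / 2) := by
  have hz0 : z ≠ 0 := Complex.integerComplement.ne_zero hz
  have h := (summable_cotTerm hz).hasSum
  rw [show (∑' n, cotTerm z n) = π * Complex.cot (π * z) - 1 / z from (cot_series_rep' hz).symm] at h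
  have h2 := h.div_const (2 * z)
  refine cc_congr (h2) (fun n => ?_) ?_
  · rw [cotTerm_identity hz]
    rw [show z ^ 2 - ((n : ℂ) + 1) ^ 2 = (z + (n + 1)) * (z - (n + 1)) by ring]
    field_simp
  · field_simp

lemma cc_cot (x : ℝ) (hx : ∀ n : ℤ, x ≠ n) :
    HasSum (fun n : ℕ => 1 / (x ^ 2 - ((n : ℝ) + 1) ^ 2))
      ((π * Real.cot (π * x) / x - 1 / x ^ 2) / 2) := by
  have h := cc_complex (x : ℂ) (by
    rintro ⟨n, hn⟩
    exact hx n (by exact_mod_cast hn.symm))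
  rw [← Complex.hasSum_ofReal]
  push_cast
  exact h

lemma cc_coth (y : ℝ) (hy : 0 < y) :
    HasSum (fun n : ℕ => 1 / (y ^ 2 + ((n : ℝ) + 1) ^ 2))
      ((π * coth (π * y) / y - 1 / y ^ 2) / 2) := by
  have h := cc_complex (y * Complex.I) (by
    rintro ⟨n, hn⟩
    have := congrArg Complex.im hn
    simp at this
    exact hy.ne this)
  rw [← Complex.hasSum_ofReal]
  have hs : Complex.sinh (π * y) ≠ 0 := by
    have : Real.sinh (π * y) ≠ 0 := (Real.sinh_pos_iff.2 (by positivity)).ne'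
    exact_mod_cast this
  have hy' : (y : ℂ) ≠ 0 := by exact_mod_cast hy.ne'
  refine cc_congr (h.neg) (fun n => ?_) ?_
  · push_cast
    rw [mul_pow, Complex.I_sq, ← one_div_neg_eq_neg_one_div]
    congr 1; ring
  · rw [Complex.cot, ← mul_assoc, Complex.cos_mul_I, Complex.sin_mul_I, coth]
    push_cast
    rw [mul_pow, Complex.I_sq]
    field_simp
    rw [Complex.I_sq]; ring

lemma cc_L2 (α β v : ℝ) (hα : 0 < α) (hβ : 0 < β) (hab : α * β = π ^ 2) (hv : 0 < v) :
    HasSum (fun m : ℕ => 1 / (v + ((m : ℝ) + 1) ^ 2 * α))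
      ((π * coth (√(v * β)) / √(v * α) - 1 / v) / 2) := by
  have hy : 0 < √(v * α) / α := by positivity
  have e1 : π * (√(v * α) / α) = √(v * β) := by
    rw [eq_comm, Real.sqrt_eq_iff_mul_self_eq (by positivity) (by positivity)]
    field_simp
    rw [Real.sq_sqrt (by positivity), ← hab]; ring
  have e2 : (√(v * α) / α) ^ 2 = v / α := by
    rw [div_pow, Real.sq_sqrt (by positivity)]; field_simp
  have h := (cc_coth _ hy).div_const α
  rw [e1, e2] at h
  refine cc_congr (h) (fun m => ?_) ?_
  · field_simp
  · field_simp

lemma cc_L1 (α β v : ℝ) (hα : 0 < α) (hβ : 0 < β) (hab : α * β = π ^ 2) (hv : 0 < v)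
    (h1 : ∀ n : ℤ, √(v * α) ≠ (n : ℝ) * π) :
    HasSum (fun m : ℕ => 1 / (v - ((m : ℝ) + 1) ^ 2 * β))
      ((π * Real.cot (√(v * α)) / √(v * β) - 1 / v) / 2) := by
  have hy : 0 < √(v * β) / β := by positivity
  have e1 : π * (√(v * β) / β) = √(v * α) := by
    rw [eq_comm, Real.sqrt_eq_iff_mul_self_eq (by positivity) (by positivity)]
    field_simp
    rw [Real.sq_sqrt (by positivity), ← hab]; ring
  have e2 : (√(v * β) / β) ^ 2 = v / β := by
    rw [div_pow, Real.sq_sqrt (by positivity)]; field_simp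
  have h := (cc_cot (√(v * β) / β) (by
    intro n hn
    apply h1 n
    rw [← e1, hn]; ring)).div_const β
  rw [e1, e2] at h
  refine cc_congr (h) (fun m => ?_) ?_
  · rw [div_div]
    congr 1; field_simp
  · field_simp

/-- Logarithm of the Euler product. -/
noncomputable def ccL (α : ℝ) : ℝ := ∑' k : ℕ, Real.log (1 - Real.exp (-2 * α) ^ (k + 1))

lemma cc_q (α : ℝ) (hα : 0 < α) : Real.exp (-2 * α) < 1 := by
  rw [Real.exp_lt_one_iff]; linarith

lemma cc_double (q : ℝ) (h0 : 0 < q) (h1 : q < 1) :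
    Summable (fun p : ℕ × ℕ => (q ^ (p.2 + 1)) ^ (p.1 + 1) / ((p.1 : ℝ) + 1)) := by
  have hg := summable_geometric_of_lt_one h0.le h1
  refine Summable.of_nonneg_of_le (fun p => by positivity) ?_
    (hg.mul_of_nonneg hg (fun n => by positivity) (fun n => by positivity))
  rintro ⟨n, k⟩
  dsimp only
  rw [← pow_mul, ← pow_add]
  refine (div_le_self (by positivity) (by have : (0:ℝ) ≤ n := by positivity
                                          linarith)).trans ?_
  exact pow_le_pow_of_le_one h0.le h1.le (by nlinarith)

lemma cc_E (α : ℝ) (hα : 0 < α) :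
    HasSum (fun n : ℕ => (coth (((n : ℝ) + 1) * α) - 1) / ((n : ℝ) + 1)) (-2 * ccL α) := by
  set q := Real.exp (-2 * α) with hq
  have h0 : 0 < q := Real.exp_pos _
  have h1 : q < 1 := cc_q α hα
  have hd := cc_double q h0 h1
  have hrow : ∀ n : ℕ, HasSum (fun k : ℕ => (q ^ (k + 1)) ^ (n + 1) / ((n : ℝ) + 1))
      ((coth (((n : ℝ) + 1) * α) - 1) / ((n : ℝ) + 1) / 2) := by
    intro n
    have hr0 : 0 < q ^ (n + 1) := by positivity
    have hr1 : q ^ (n + 1) < 1 := pow_lt_one₀ h0.le h1 (by omega)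
    have := ((hasSum_geometric_of_lt_one hr0.le hr1).mul_left (q ^ (n + 1))).div_const ((n : ℝ) + 1)
    refine cc_congr (this) (fun k => ?_) ?_
    · rw [← pow_succ', pow_right_comm]
    · have e : q ^ (n + 1) = Real.exp (-(((n : ℝ) + 1) * α)) ^ 2 := by
        rw [hq, ← Real.exp_nat_mul, ← Real.exp_nat_mul]; congr 1; push_cast; ring
      have hs : 0 < Real.sinh (((n : ℝ) + 1) * α) := Real.sinh_pos_iff.2 (by positivity)
      rw [e] at hr1 ⊢
      rw [coth]
      rw [Real.sinh_eq] at hs ⊢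
      rw [Real.cosh_eq]
      have e3 : Real.exp (((n : ℝ) + 1) * α) = (Real.exp (-(((n : ℝ) + 1) * α)))⁻¹ := by
        rw [Real.exp_neg, inv_inv]
      rw [e3] at hs ⊢
      have hu : 0 < Real.exp (-(((n : ℝ) + 1) * α)) := Real.exp_pos _
      generalize Real.exp (-(((n : ℝ) + 1) * α)) = u at *
      have : 1 - u ^ 2 ≠ 0 := by linarith
      have h3 : u⁻¹ - u = (1 - u ^ 2) / u := by field_simp
      rw [h3]
      field_simp
      ring
  have hcol : ∀ k : ℕ, HasSum (fun n : ℕ => (q ^ (k + 1)) ^ (n + 1) / ((n : ℝ) + 1))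
      (-Real.log (1 - q ^ (k + 1))) := by
    intro k
    apply Real.hasSum_pow_div_log_of_abs_lt_one
    rw [abs_of_pos (by positivity)]
    exact pow_lt_one₀ h0.le h1 (by omega)
  have s1 := hd.hasSum.prod_fiberwise hrow
  have hd' := hd.prod_symm
  have s2 := hd'.hasSum.prod_fiberwise hcol
  have s12 : ∑' p : ℕ × ℕ, (q ^ (p.2 + 1)) ^ (p.1 + 1) / ((p.1 : ℝ) + 1) = - ccL α := by
    rw [ccL, ← tsum_neg, s2.tsum_eq, ← (Equiv.prodComm ℕ ℕ).tsum_eq]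
    rfl
  rw [s12] at s1
  have := s1.mul_left 2
  refine cc_congr (this) (fun n => ?_) ?_
  ·  ring
  · ring

lemma cc_logsummable (α : ℝ) (hα : 0 < α) :
    Summable (fun k : ℕ => Real.log (1 - Real.exp (-2 * α) ^ (k + 1))) := by
  have h0 : 0 < Real.exp (-2 * α) := Real.exp_pos _
  have h1 := cc_q α hα
  have hg := (summable_geometric_of_lt_one h0.le h1).mul_left (Real.exp (-2 * α))
  have : Summable (fun k : ℕ => Real.log (1 + -(Real.exp (-2 * α) ^ (k + 1)))) := by
    apply Real.summable_log_one_add_of_summable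
    apply Summable.neg
    simpa only [pow_succ'] using hg
  simpa only [sub_eq_add_neg] using this

lemma cc_eta (α : ℝ) (hα : 0 < α) :
    ModularForm.eta (((α / π : ℝ) : ℂ) * Complex.I) = ((Real.exp (-α / 12 + ccL α) : ℝ) : ℂ) := by
  have h0 : 0 < Real.exp (-2 * α) := Real.exp_pos _
  have h1 := cc_q α hα
  have hp : (π : ℂ) ≠ 0 := by exact_mod_cast Real.pi_ne_zero
  have hprod : HasProd (fun k : ℕ => 1 - Real.exp (-2 * α) ^ (k + 1)) (Real.exp (ccL α)) := by
    have := (cc_logsummable α hα).hasSum.rexp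
    have e : (Real.exp ∘ fun k : ℕ => Real.log (1 - Real.exp (-2 * α) ^ (k + 1))) =
        fun k : ℕ => 1 - Real.exp (-2 * α) ^ (k + 1) := by
      funext k
      exact Real.exp_log (by linarith [pow_lt_one₀ h0.le h1 (show k + 1 ≠ 0 by omega)])
    rw [e] at this
    exact this
  have hprod' : HasProd (fun k : ℕ => ((1 - Real.exp (-2 * α) ^ (k + 1) : ℝ) : ℂ))
      ((Real.exp (ccL α) : ℝ) : ℂ) := hprod.map Complex.ofRealHom Complex.continuous_ofReal
  rw [ModularForm.eta, Real.exp_add, Complex.ofReal_mul, ← hprod'.tprod_eq]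
  congr 1
  · rw [Function.Periodic.qParam]
    push_cast
    congr 1
    field_simp
    rw [Complex.I_sq]; ring
  · apply tprod_congr
    intro k
    rw [ModularForm.eta_q_eq_pow]
    push_cast
    congr 3
    field_simp
    rw [Complex.I_sq]; ring

lemma cc_trans (α β : ℝ) (hα : 0 < α) (hβ : 0 < β) (hab : α * β = π ^ 2) :
    -β / 12 + ccL β = 1 / 2 * Real.log (α / π) + (-α / 12 + ccL α) := by
  have hp := Real.pi_pos
  have h := ModularForm.eta_comp_eq_csqrt_I_inv
    (show ((α / π : ℝ) : ℂ) * Complex.I ∈ UpperHalfPlane.upperHalfPlaneSet by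
      simp [UpperHalfPlane.upperHalfPlaneSet]; positivity)
  have e : -1 / (((α / π : ℝ) : ℂ) * Complex.I) = ((β / π : ℝ) : ℂ) * Complex.I := by
    have e1 : β / π = π / α := by field_simp; linarith
    rw [e1]
    have hp' : (π : ℂ) ≠ 0 := by exact_mod_cast Real.pi_ne_zero
    have ha' : (α : ℂ) ≠ 0 := by exact_mod_cast hα.ne'
    push_cast
    field_simp
    rw [Complex.I_sq]
  simp only [Function.comp_apply, e, Pi.smul_apply, Pi.mul_apply, smul_eq_mul,
    cc_eta α hα, cc_eta β hβ] at h
  have hn := congrArg norm h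
  have hs : ∀ z : ℂ, z ≠ 0 → ‖Complex.sqrt z‖ = Real.exp (1 / 2 * Real.log ‖z‖) := by
    intro z hz
    rw [Complex.sqrt, Complex.cpow_def_of_ne_zero hz, Complex.norm_exp]
    congr 1
    simp [Complex.log_re]
    ring
  have ha' : ((α / π : ℝ) : ℂ) ≠ 0 := by
    have : α / π ≠ 0 := by positivity
    exact_mod_cast this
  simp only [norm_mul, norm_inv, hs _ Complex.I_ne_zero, hs _ (mul_ne_zero ha' Complex.I_ne_zero),
    Complex.norm_I, Complex.norm_real, Real.norm_eq_abs, Real.abs_exp,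
    abs_of_pos (show 0 < α / π by positivity)] at hn
  simp only [Real.log_one, mul_zero, Real.exp_zero, inv_one, one_mul, mul_one, ← Real.exp_add] at hn
  exact Real.exp_injective hn

lemma cc_const (α β : ℝ) (hα : 0 < α) (hβ : 0 < β) (hab : α * β = π ^ 2) :
    HasSum (fun n : ℕ => (coth (((n : ℝ) + 1) * α) - coth (((n : ℝ) + 1) * β)) / ((n : ℝ) + 1))
      ((β - α) / 6 - 1 / 2 * Real.log (β / α)) := by
  have h := (cc_E α hα).sub (cc_E β hβ)
  have ht := cc_trans α β hα hβ hab
  have hl : 2 * Real.log (α / π) = - Real.log (β / α) := by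
    rw [← Real.log_inv, ← Nat.cast_ofNat, ← Real.log_pow]
    congr 1
    have := Real.pi_pos
    rw [div_pow, ← hab]; field_simp
  refine cc_congr (h) (fun n => ?_) ?_
  ·  ring
  · linarith

theorem cot_coth_partial_fraction (α β w : ℝ) (hα : 0 < α) (hβ : 0 < β)
    (hab : α * β = Real.pi ^ 2) (hw : 0 < w)
    (h1 : ∀ n : ℤ, Real.sqrt (w * α) ≠ (n : ℝ) * Real.pi)
    (h2 : ∀ n : ℕ, 0 < n → w ≠ (n : ℝ) ^ 2 * β) :
    Real.pi / 2 * Real.cot (Real.sqrt (w * α)) * coth (Real.sqrt (w * β))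
      = 1 / (2 * w) + 1 / 2 * Real.log (β / α)
        + ∑' n : ℕ,
            (((n : ℝ) + 1) * α * coth (((n : ℝ) + 1) * α) / (w + ((n : ℝ) + 1) ^ 2 * α)
              + ((n : ℝ) + 1) * β * coth (((n : ℝ) + 1) * β) / (w - ((n : ℝ) + 1) ^ 2 * β)) := by
  have hp := Real.pi_pos
  have hA := cc_L1 α β w hα hβ hab hw h1
  have hB := cc_L2 α β w hα hβ hab hw
  have hprod : √(w * α) * √(w * β) = w * π := by
    rw [← Real.sqrt_mul (by positivity), show w * α * (w * β) = (w * π) ^ 2 by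
      rw [mul_pow, ← hab]; ring]
    exact Real.sqrt_sq (by positivity)
  have hsα : 0 < √(w * α) := by positivity
  have hsβ : 0 < √(w * β) := by positivity
  set A := (π * Real.cot (√(w * α)) / √(w * β) - 1 / w) / 2 with hAdef
  set B := (π * coth (√(w * β)) / √(w * α) - 1 / w) / 2 with hBdef
  have hS : π * Real.cot (√(w * α)) * coth (√(w * β)) = w * ((1 / w + 2 * A) * (1 / w + 2 * B)) := by
    have e1 : 1 / w + 2 * A = π * Real.cot (√(w * α)) / √(w * β) := by rw [hAdef]; ring
    have e2 : 1 / w + 2 * B = π * coth (√(w * β)) / √(w * α) := by rw [hBdef]; ring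
    rw [e1, e2, div_mul_div_comm, mul_comm (√(w * β)), hprod]
    field_simp
  -- zeta(2)
  have hz : HasSum (fun n : ℕ => 1 / ((n : ℝ) + 1) ^ 2) (π ^ 2 / 6) := by
    have := (hasSum_nat_add_iff' 1).2 hasSum_zeta_two
    simpa using this
  have hzα : HasSum (fun n : ℕ => 1 / (((n : ℝ) + 1) ^ 2 * α)) (β / 6) := by
    refine cc_congr (hz.div_const α) (fun n => ?_) ?_
    ·  field_simp
    · rw [← hab]; field_simp
  have hzβ : HasSum (fun n : ℕ => 1 / (((n : ℝ) + 1) ^ 2 * β)) (α / 6) := by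
    refine cc_congr (hz.div_const β) (fun n => ?_) ?_
    ·  field_simp
    · rw [← hab]; field_simp
  have hane : ∀ n : ℕ, w - ((n : ℝ) + 1) ^ 2 * β ≠ 0 := by
    intro n
    have := h2 (n + 1) (by omega)
    push_cast at this
    exact sub_ne_zero.2 this
  set a : ℕ → ℝ := fun n => 1 / (w - ((n : ℝ) + 1) ^ 2 * β) with ha
  set b : ℕ → ℝ := fun n => 1 / (w + ((n : ℝ) + 1) ^ 2 * α) with hb
  have hbpos : ∀ n, 0 < b n := fun n => by simp only [hb]; positivity
  -- the kernel
  have hrow : ∀ n : ℕ, HasSum (fun m : ℕ => 1 / (((n : ℝ) + 1) ^ 2 * β + ((m : ℝ) + 1) ^ 2 * α))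
      ((coth (((n : ℝ) + 1) * β) / ((n : ℝ) + 1) - 1 / (((n : ℝ) + 1) ^ 2 * β)) / 2) := by
    intro n
    have := cc_L2 α β (((n : ℝ) + 1) ^ 2 * β) hα hβ hab (by positivity)
    rw [show ((n : ℝ) + 1) ^ 2 * β * β = (((n : ℝ) + 1) * β) ^ 2 by ring,
      show ((n : ℝ) + 1) ^ 2 * β * α = (((n : ℝ) + 1) * π) ^ 2 by rw [mul_pow _ π, ← hab]; ring,
      Real.sqrt_sq (by positivity), Real.sqrt_sq (by positivity)] at this
    convert this using 3
    field_simp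
  have hcol : ∀ m : ℕ, HasSum (fun n : ℕ => 1 / (((n : ℝ) + 1) ^ 2 * β + ((m : ℝ) + 1) ^ 2 * α))
      ((coth (((m : ℝ) + 1) * α) / ((m : ℝ) + 1) - 1 / (((m : ℝ) + 1) ^ 2 * α)) / 2) := by
    intro m
    have := cc_L2 β α (((m : ℝ) + 1) ^ 2 * α) hβ hα (by linarith) (by positivity)
    rw [show ((m : ℝ) + 1) ^ 2 * α * α = (((m : ℝ) + 1) * α) ^ 2 by ring,
      show ((m : ℝ) + 1) ^ 2 * α * β = (((m : ℝ) + 1) * π) ^ 2 by rw [mul_pow _ π, ← hab]; ring,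
      Real.sqrt_sq (by positivity), Real.sqrt_sq (by positivity)] at this
    convert this using 3
    · ring
    · field_simp
  have hF : Summable (fun p : ℕ × ℕ =>
      a p.1 * (1 / (((p.1 : ℝ) + 1) ^ 2 * β + ((p.2 : ℝ) + 1) ^ 2 * α))) := by
    refine Summable.of_norm_bounded (hA.summable.norm.mul_of_nonneg hzα.summable
      (fun n => norm_nonneg _) (fun n => by positivity)) ?_
    rintro ⟨n, m⟩
    dsimp only
    rw [norm_mul]
    refine mul_le_mul_of_nonneg_left ?_ (norm_nonneg _)
    rw [Real.norm_of_nonneg (by positivity)]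
    apply one_div_le_one_div_of_le (by positivity)
    have : 0 < ((n : ℝ) + 1) ^ 2 * β := by positivity
    linarith
  have hG : Summable (fun p : ℕ × ℕ =>
      b p.2 * (1 / (((p.1 : ℝ) + 1) ^ 2 * β + ((p.2 : ℝ) + 1) ^ 2 * α))) := by
    refine Summable.of_norm_bounded (hzβ.summable.mul_of_nonneg hB.summable
      (fun n => by positivity) (fun n => (hbpos n).le)) ?_
    rintro ⟨n, m⟩
    dsimp only
    rw [norm_mul, mul_comm, Real.norm_of_nonneg (hbpos m).le]
    refine mul_le_mul_of_nonneg_right ?_ (hbpos m).le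
    rw [Real.norm_of_nonneg (by positivity)]
    apply one_div_le_one_div_of_le (by positivity)
    have : 0 < ((m : ℝ) + 1) ^ 2 * α := by positivity
    linarith
  have hFs := hF.hasSum.prod_fiberwise (fun n => (hrow n).mul_left (a n))
  have hGs := hG.prod_symm.hasSum.prod_fiberwise (fun m => (hcol m).mul_left (b m))
  have hGe : ∑' p : ℕ × ℕ, b p.swap.2 *
      (1 / (((p.swap.1 : ℝ) + 1) ^ 2 * β + ((p.swap.2 : ℝ) + 1) ^ 2 * α)) =
      ∑' p : ℕ × ℕ, b p.2 * (1 / (((p.1 : ℝ) + 1) ^ 2 * β + ((p.2 : ℝ) + 1) ^ 2 * α)) :=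
    (Equiv.prodComm ℕ ℕ).tsum_eq (fun p : ℕ × ℕ =>
      b p.2 * (1 / (((p.1 : ℝ) + 1) ^ 2 * β + ((p.2 : ℝ) + 1) ^ 2 * α)))
  rw [hGe] at hGs
  have hAB : A * B = (∑' p : ℕ × ℕ,
      a p.1 * (1 / (((p.1 : ℝ) + 1) ^ 2 * β + ((p.2 : ℝ) + 1) ^ 2 * α))) -
      ∑' p : ℕ × ℕ, b p.2 * (1 / (((p.1 : ℝ) + 1) ^ 2 * β + ((p.2 : ℝ) + 1) ^ 2 * α)) := by
    rw [← hF.tsum_sub hG]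
    have hn : Summable (fun p : ℕ × ℕ => a p.1 * b p.2) :=
      summable_mul_of_summable_norm hA.summable.norm hB.summable.norm
    rw [← hA.tsum_eq, ← hB.tsum_eq, hA.summable.tsum_mul_tsum hB.summable hn]
    apply tsum_congr
    rintro ⟨n, m⟩
    simp only [ha, hb]
    have q1 := hane n
    have q2 : w + ((m : ℝ) + 1) ^ 2 * α ≠ 0 := by positivity
    have q3 : ((n : ℝ) + 1) ^ 2 * β + ((m : ℝ) + 1) ^ 2 * α ≠ 0 := by positivity
    rw [← sub_mul, div_sub_div _ _ q1 q2, div_mul_div_comm, div_mul_div_comm,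
      div_eq_div_iff (mul_ne_zero q1 q2) (mul_ne_zero (mul_ne_zero q1 q2) q3)]
    ring
  set F := ∑' p : ℕ × ℕ,
      a p.1 * (1 / (((p.1 : ℝ) + 1) ^ 2 * β + ((p.2 : ℝ) + 1) ^ 2 * α))
  set G := ∑' p : ℕ × ℕ, b p.2 * (1 / (((p.1 : ℝ) + 1) ^ 2 * β + ((p.2 : ℝ) + 1) ^ 2 * α))
  have hc := cc_const α β hα hβ hab
  have hfin := (hc.add ((hFs.sub hGs).mul_left (2 * w))).add
    ((hzβ.add hA).sub (hzα.sub hB))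
  have hterm : HasSum (fun n : ℕ => 
      (((n : ℝ) + 1) * α * coth (((n : ℝ) + 1) * α) / (w + ((n : ℝ) + 1) ^ 2 * α)
        + ((n : ℝ) + 1) * β * coth (((n : ℝ) + 1) * β) / (w - ((n : ℝ) + 1) ^ 2 * β)))
      ((β - α) / 6 - 1 / 2 * Real.log (β / α) + 2 * w * (F - G) + (α / 6 + A - (β / 6 - B))) := by
    refine cc_congr hfin (fun n => ?_) rfl
    simp only [ha, hb]
    have q1 := hane n
    have q2 : w + ((n : ℝ) + 1) ^ 2 * α ≠ 0 := by positivity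
    have q3 : (n : ℝ) + 1 ≠ 0 := by positivity
    generalize coth (((n : ℝ) + 1) * α) = c
    generalize coth (((n : ℝ) + 1) * β) = d
    generalize (n : ℝ) + 1 = k at *
    field_simp
    ring
  rw [hterm.tsum_eq]
  have : Real.pi / 2 * Real.cot (Real.sqrt (w * α)) * coth (Real.sqrt (w * β)) =
    (w * ((1 / w + 2 * A) * (1 / w + 2 * B))) / 2 := by rw [← hS]; ring
  rw [this, show w * ((1 / w + 2 * A) * (1 / w + 2 * B)) = 1 / w + 2 * A + 2 * B + 4 * w * (A * B) by
    field_simp; ring, hAB]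
  field_simp
  ring
end

section
/- If α and β are positive reals with αβ = π² and w > 0 is such that √(wα) is not an integer multiple of π and w ≠ n²β for all positive integers n, then π/(2 sin(√(wα)) sinh(√(wβ))) = 1/(2w) + Σ_{n=1}^∞ { nα(-1)^n/(sinh(nα)(w + n²α)) + nβ(-1)^n/(sinh(nβ)(w - n²β)) }. -/
open Real

noncomputable def cfA (n : ℕ) : ℝ := (-1) ^ n * (if n = 0 then 1 else 2)

lemma cf_congr {R : Type*} [AddCommMonoid R] [TopologicalSpace R] {f g : ℕ → R} {a b : R}
    (h : HasSum f a) (hfg : ∀ n, g n = f n) (hab : b = a) : HasSum g b := by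
  rw [hab, funext hfg]; exact h

open Complex in
lemma cf_cot (x : ℂ) (hx : x ∈ Complex.integerComplement) :
    HasSum (fun n : ℕ => (if n = 0 then 1 else 2) * x / (x ^ 2 - (n : ℂ) ^ 2))
      (π * Complex.cot (π * x)) := by
  have h := (summable_cotTerm hx).hasSum
  have h' : ∑' n, cotTerm x n = π * Complex.cot (π * x) - 1 / x := (cot_series_rep' hx).symm
  rw [h'] at h
  rw [← hasSum_nat_add_iff' 1]
  have hx0 : x ≠ 0 := Complex.integerComplement.ne_zero hx
  refine cf_congr h (fun n => ?_) ?_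
  · have hp0 := Real.pi_pos
    rw [cotTerm_identity hx]
    have : (x + (n+1)) * (x - (n+1)) = x ^ 2 - ((n:ℂ)+1) ^ 2 := by ring
    rw [this]
    simp
    ring
  · simp
    field_simp

open Complex in
lemma cf_csc (x : ℂ) (hx : x ∈ Complex.integerComplement) :
    HasSum (fun n : ℕ => (cfA n : ℂ) / (x ^ 2 - (n : ℂ) ^ 2))
      (π / (x * Complex.sin (π * x))) := by
  have hx0 : x ≠ 0 := Complex.integerComplement.ne_zero hx
  have hx2 : x / 2 ∈ Complex.integerComplement := by
    rw [Complex.mem_integerComplement_iff] at hx ⊢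
    rintro ⟨n, hn⟩
    exact hx ⟨2 * n, by push_cast; rw [hn]; ring⟩
  have e1 := cf_cot x hx
  have e2 := cf_cot (x / 2) hx2
  have inj : Function.Injective (fun n : ℕ => 2 * n) := fun a b h => by simpa using h
  have e3 : HasSum (fun n : ℕ => if Even n then (if n = 0 then 1 else 2) * (2 * x) / (x ^ 2 - (n : ℂ) ^ 2) else 0)
      (π * Complex.cot (π * (x / 2))) := by
    rw [← inj.hasSum_iff]
    · refine cf_congr e2 (fun n => ?_) rfl
      have : (x / 2) ^ 2 - (n : ℂ) ^ 2 = (x ^ 2 - (2 * (n:ℂ)) ^ 2) / 4 := by ring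
      simp only [Function.comp, even_two_mul, if_true, this]
      have : (2 * n = 0) ↔ n = 0 := by omega
      simp only [this, Nat.cast_mul, Nat.cast_ofNat]
      rw [div_div_eq_mul_div]
      congr 1
      ring
    · intro n hn
      have : ¬ Even n := by
        rintro ⟨k, hk⟩
        exact hn ⟨k, by simp; omega⟩
      simp [this]
  have e4 := (e3.sub e1).div_const x
  refine cf_congr e4 (fun n => ?_) ?_
  · have hp0 := Real.pi_pos
    rw [cfA]
    rcases Nat.even_or_odd n with h | h
    · simp only [h, if_true, h.neg_one_pow]
      split_ifs <;> push_cast <;> field_simp <;> ring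
    · have h' : ¬ Even n := by simpa using h
      simp only [h', if_false, h.neg_one_pow]
      split_ifs <;> push_cast <;> field_simp <;> ring
  · have s1 := sin_pi_mul_ne_zero hx
    have s2 := sin_pi_mul_ne_zero hx2
    have d : (π:ℂ) * x = 2 * (π * (x / 2)) := by ring
    simp only [Complex.cot]
    rw [d, Complex.sin_two_mul] at s1
    rw [d, Complex.sin_two_mul, Complex.cos_two_mul]
    generalize (π:ℂ) * (x / 2) = z at *
    have : Complex.cos z ≠ 0 := by
      intro h; apply s1; simp [h]
    field_simp
    ring

lemma cf_sin (x : ℝ) (hx : ∀ n : ℤ, x ≠ n) :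
    HasSum (fun n : ℕ => cfA n / (x ^ 2 - (n : ℝ) ^ 2)) (π / (x * sin (π * x))) := by
  rw [← Complex.hasSum_ofReal]
  have := cf_csc (x : ℂ) (by
    rw [Complex.mem_integerComplement_iff]
    rintro ⟨n, hn⟩
    exact hx n (by exact_mod_cast hn.symm))
  push_cast
  exact this

lemma cf_sinh (y : ℝ) (hy : 0 < y) :
    HasSum (fun n : ℕ => cfA n / (y ^ 2 + (n : ℝ) ^ 2)) (π / (y * sinh (π * y))) := by
  rw [← Complex.hasSum_ofReal]
  have := cf_csc (y * Complex.I : ℂ) (by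
    rw [Complex.mem_integerComplement_iff]
    rintro ⟨n, hn⟩
    have := congrArg Complex.im hn
    simp at this
    exact hy.ne this)
  rw [← mul_assoc, Complex.sin_mul_I] at this
  have := this.neg
  push_cast
  refine cf_congr this (fun n => ?_) ?_
  · have hp0 := Real.pi_pos
    rw [mul_pow, Complex.I_sq, ← div_neg]
    congr 1
    ring
  · rw [← div_neg]
    congr 1
    linear_combination ((y:ℂ) * Complex.sinh (π * y)) * Complex.I_sq

lemma cf_sinh_ge (x : ℝ) (hx : 0 ≤ x) : x ^ 2 / 4 ≤ sinh x := by
  rw [sinh_eq]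
  have h1 := quadratic_le_exp_of_nonneg hx
  have h2 : exp (-x) ≤ 1 := by simpa using hx
  linarith

lemma cfA_ge (n : ℕ) : 1 ≤ |cfA n| := by
  rw [cfA, abs_mul, abs_pow]; split_ifs <;> simp

lemma cf_summable {f : ℕ → ℝ} {s : ℝ} (h : HasSum (fun n => cfA n / f n) s) :
    Summable (fun n => |cfA n / f n|) ∧ Summable (fun n => 1 / |f n|) := by
  refine ⟨h.summable.abs, Summable.of_nonneg_of_le (fun n => by positivity) (fun n => ?_) h.summable.abs⟩
  rw [abs_div]
  have := cfA_ge n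
  gcongr

lemma cf_R1 (α β w : ℝ) (hα : 0 < α) (hβ : 0 < β) (hab : α * β = π ^ 2) (hw : 0 < w)
    (h1 : ∀ n : ℤ, √(w * α) ≠ (n : ℝ) * π) :
    HasSum (fun n : ℕ => cfA n / (w - (n : ℝ) ^ 2 * β))
      (π ^ 2 / (β * √(w * α) * sin (√(w * α)))) := by
  have hp := pi_pos
  have h := (cf_sin (√(w * α) / π) (fun n hn => h1 n (by rw [← hn]; field_simp))).div_const β
  have hs : √(w * α) ^ 2 = w * α := sq_sqrt (by positivity)
  refine cf_congr h (fun n => ?_) ?_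
  · have hp0 := Real.pi_pos
    rw [div_div]
    congr 1
    rw [div_pow, hs, ← hab]
    field_simp
  · rw [mul_div_cancel₀ _ hp.ne']
    field_simp

lemma cf_R2 (α β c : ℝ) (hα : 0 < α) (hβ : 0 < β) (hab : α * β = π ^ 2) (hc : 0 < c) :
    HasSum (fun n : ℕ => cfA n / (c + (n : ℝ) ^ 2 * α))
      (π ^ 2 / (α * √(c * β) * sinh (√(c * β)))) := by
  have hp := pi_pos
  have h := (cf_sinh (√(c * β) / π) (by positivity)).div_const α
  have hs : √(c * β) ^ 2 = c * β := sq_sqrt (by positivity)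
  refine cf_congr h (fun n => ?_) ?_
  · have hp0 := Real.pi_pos
    rw [div_div]
    congr 1
    rw [div_pow, hs, ← hab]
    field_simp
  · rw [mul_div_cancel₀ _ hp.ne']
    field_simp

lemma cf_R3 (α β : ℝ) (hα : 0 < α) (hβ : 0 < β) (hab : α * β = π ^ 2) (n : ℕ) (hn : n ≠ 0) :
    HasSum (fun m : ℕ => cfA m / ((n : ℝ) ^ 2 * β + (m : ℝ) ^ 2 * α)) (1 / (n * sinh (n * β))) := by
  have hn' : (0:ℝ) < n := by positivity
  have h := cf_R2 α β (n ^ 2 * β) hα hβ hab (by positivity)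
  have : √((n:ℝ) ^ 2 * β * β) = n * β := by
    rw [show (n:ℝ) ^ 2 * β * β = (n * β) ^ 2 by ring]; exact sqrt_sq (by positivity)
  rw [this, ← hab] at h
  refine cf_congr h (fun n => rfl) ?_
  field_simp

noncomputable def cfK (α β : ℝ) (p : ℕ × ℕ) : ℝ :=
  if p.1 = 0 then (if p.2 = 0 then 0 else cfA p.2 / ((p.2 : ℝ) ^ 2 * α))
  else if p.2 = 0 then - (cfA p.1 / ((p.1 : ℝ) ^ 2 * β)) else 0

noncomputable def cfG (α β : ℝ) (d : ℕ → ℝ) (p : ℕ × ℕ) : ℝ :=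
  if p.1 = 0 then 0 else cfA p.1 / d p.1 * (cfA p.2 / ((p.1 : ℝ) ^ 2 * β + (p.2 : ℝ) ^ 2 * α))

lemma cfA_zero : cfA 0 = 1 := by simp [cfA]

lemma cfA_succ (n : ℕ) : cfA (n + 1) = 2 * (-1) ^ (n + 1) := by simp [cfA]; ring

/-- the sum of one half of the double series, as a single series -/
lemma cfG_hasSum (α β : ℝ) (hα : 0 < α) (hβ : 0 < β) (hab : α * β = π ^ 2) (d : ℕ → ℝ)
    (hd : Summable (fun n => |cfA n / d n|)) :
    ∃ s, HasSum (cfG α β d) s ∧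
      HasSum (fun n : ℕ => 2 * (-1) ^ (n + 1) / d (n + 1) * (1 / (((n : ℝ) + 1) * sinh (((n : ℝ) + 1) * β)))) s := by
  have hb := (cf_summable (cf_R2 α β β hα hβ hab hβ)).1
  have hs : Summable (cfG α β d) := by
    refine Summable.of_norm_bounded (hd.mul_of_nonneg hb (fun n => abs_nonneg _) (fun n => abs_nonneg _)) ?_
    rintro ⟨n, m⟩
    simp only [cfG]
    split_ifs with h
    · simp; positivity
    · rw [norm_eq_abs, abs_mul]
      have h1 : (1:ℝ) ≤ n := by exact_mod_cast Nat.one_le_iff_ne_zero.2 h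
      have h2 : β ≤ (n:ℝ) ^ 2 * β := le_mul_of_one_le_left hβ.le (one_le_pow₀ h1)
      apply mul_le_mul_of_nonneg_left _ (abs_nonneg _)
      rw [abs_div, abs_div, abs_of_pos (by positivity : 0 < (n:ℝ) ^ 2 * β + (m:ℝ) ^ 2 * α),
        abs_of_pos (by positivity : 0 < β + (m:ℝ) ^ 2 * α)]
      gcongr
  refine ⟨_, hs.hasSum, ?_⟩
  have := hs.hasSum.prod_fiberwise
    (g := fun n => if n = 0 then 0 else cfA n / d n * (1 / ((n : ℝ) * sinh (n * β)))) (by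
      intro n
      simp only [cfG]
      split_ifs with h
      · exact hasSum_zero
      · exact (cf_R3 α β hα hβ hab n h).mul_left _)
  rw [← hasSum_nat_add_iff' 1] at this
  refine cf_congr this (fun n => ?_) (by simp)
  simp [cfA_succ]

noncomputable def cfT (α β w : ℝ) (n : ℕ) : ℝ :=
  (((n : ℝ) + 1) * α * (-1 : ℝ) ^ (n + 1)
                / (Real.sinh (((n : ℝ) + 1) * α) * (w + ((n : ℝ) + 1) ^ 2 * α))
              + ((n : ℝ) + 1) * β * (-1 : ℝ) ^ (n + 1)
                / (Real.sinh (((n : ℝ) + 1) * β) * (w - ((n : ℝ) + 1) ^ 2 * β)))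

noncomputable def cfU (γ : ℝ) (n : ℕ) : ℝ := (-1) ^ (n + 1) / (((n : ℝ) + 1) * sinh (((n : ℝ) + 1) * γ))

lemma cf_summ_sq (c : ℝ) : Summable (fun n : ℕ => c / ((n : ℝ) + 1) ^ 2) := by
  have := (summable_nat_add_iff (f := fun n : ℕ => 1 / (n : ℝ) ^ 2) 1).2 
    (summable_one_div_nat_pow.2 one_lt_two)
  simpa [div_eq_mul_inv] using this.mul_left c

lemma cfU_summable (γ : ℝ) (hγ : 0 < γ) : Summable (cfU γ) := by
  refine Summable.of_norm_bounded (cf_summ_sq (1 / γ)) (fun n => ?_)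
  have : ((n:ℝ) + 1) * γ ≤ sinh (((n : ℝ) + 1) * γ) := self_le_sinh_iff.2 (by positivity)
  rw [cfU, norm_div, norm_pow, norm_neg, norm_one, one_pow, norm_eq_abs, div_div,
    abs_of_pos (by have : 0 < sinh (((n : ℝ) + 1) * γ) := sinh_pos_iff.2 (by positivity)
                   positivity)]
  apply one_div_le_one_div_of_le (by positivity)
  calc γ * ((n:ℝ) + 1) ^ 2 = (n + 1) * ((n + 1) * γ) := by ring
    _ ≤ _ := by gcongr

lemma cf_kk (α β w : ℝ) (hα : 0 < α) (hβ : 0 < β) (hw : 0 < w)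
    (h2 : ∀ n : ℕ, 0 < n → w ≠ (n : ℝ) ^ 2 * β) (p : ℕ × ℕ) :
  w * (cfA p.1 / (w - (p.1 : ℝ) ^ 2 * β) * (cfA p.2 / (w + (p.2 : ℝ) ^ 2 * α))
    - cfG α β (fun n => w - (n : ℝ) ^ 2 * β) p
    + cfG β α (fun n => w + (n : ℝ) ^ 2 * α) (p.2, p.1)
    - (if p = (0, 0) then 1 / w ^ 2 else 0)) = cfK α β p := by
  obtain ⟨n, m⟩ := p
  have d2 : w + (m:ℝ) ^ 2 * α ≠ 0 := by positivity
  rcases Nat.eq_zero_or_pos n with rfl | hn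
  · rcases Nat.eq_zero_or_pos m with rfl | hm
    · simp [cfG, cfK, cfA_zero]; field_simp; simp
    · have : (m:ℝ) ≠ 0 := by positivity
      simp [cfG, cfK, cfA_zero, hm.ne']; field_simp; ring
  · have d1 : w - (n:ℝ) ^ 2 * β ≠ 0 := sub_ne_zero.2 (h2 n hn)
    have : (n:ℝ) ≠ 0 := by positivity
    rcases Nat.eq_zero_or_pos m with rfl | hm
    · simp [cfG, cfK, cfA_zero, hn.ne']; field_simp; ring
    · have : (m:ℝ) ≠ 0 := by positivity
      have d3 : (n:ℝ) ^ 2 * β + (m:ℝ) ^ 2 * α ≠ 0 := by positivity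
      have d4 : (m:ℝ) ^ 2 * α + (n:ℝ) ^ 2 * β ≠ 0 := by positivity
      simp [cfG, cfK, hn.ne', hm.ne']
      right
      rw [add_comm ((m:ℝ) ^ 2 * α)]
      field_simp; ring

lemma cf_tt (α β w : ℝ) (hα : 0 < α) (hβ : 0 < β) (hw : 0 < w)
    (h2 : ∀ n : ℕ, 0 < n → w ≠ (n : ℝ) ^ 2 * β) (n : ℕ) :
    cfT α β w n = w / 2 * (2 * (-1) ^ (n + 1) / (w - ((n + 1 : ℕ) : ℝ) ^ 2 * β) *
        (1 / (((n : ℝ) + 1) * sinh (((n : ℝ) + 1) * β)))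
      - 2 * (-1) ^ (n + 1) / (w + ((n + 1 : ℕ) : ℝ) ^ 2 * α) *
        (1 / (((n : ℝ) + 1) * sinh (((n : ℝ) + 1) * α)))) - cfU β n + cfU α n := by
  have p1 : 0 < sinh (((n : ℝ) + 1) * α) := sinh_pos_iff.2 (by positivity)
  have p2 : 0 < sinh (((n : ℝ) + 1) * β) := sinh_pos_iff.2 (by positivity)
  have d1 : w - ((n:ℝ) + 1) ^ 2 * β ≠ 0 := by
    have := h2 (n + 1) (by omega)
    push_cast at this
    exact sub_ne_zero.2 this
  have d2 : w + ((n:ℝ) + 1) ^ 2 * α ≠ 0 := by positivity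
  have d3 : (n:ℝ) + 1 ≠ 0 := by positivity
  simp only [cfT, cfU]
  push_cast
  generalize sinh (((n : ℝ) + 1) * α) = x at *
  generalize sinh (((n : ℝ) + 1) * β) = y at *
  generalize (-1 : ℝ) ^ (n + 1) = z at *
  have hx := p1.ne'
  have hy := p2.ne'
  field_simp
  ring

lemma cf_swap {f : ℕ × ℕ → ℝ} {a : ℝ} (h : HasSum f a) :
    HasSum (fun p : ℕ × ℕ => f (p.2, p.1)) a :=
  (Equiv.hasSum_iff (f := f) (Equiv.prodComm ℕ ℕ)).2 h

lemma cf_main (α β : ℝ) (hα : 0 < α) (hβ : 0 < β) (hab : α * β = π ^ 2) :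
    ∃ D : ℝ, ∀ w : ℝ, 0 < w → (∀ n : ℤ, √(w * α) ≠ (n : ℝ) * π) →
      (∀ n : ℕ, 0 < n → w ≠ (n : ℝ) ^ 2 * β) →
      π / (2 * sin (√(w * α)) * sinh (√(w * β))) = 1 / (2 * w) + ∑' n, cfT α β w n + D := by
  refine ⟨(∑' p, cfK α β p) / 2 + ∑' n, cfU β n - ∑' n, cfU α n, fun w hw h1 h2 => ?_⟩
  have hp := pi_pos
  have hba : β * α = π ^ 2 := by rw [mul_comm]; exact hab
  have r1 := cf_R1 α β w hα hβ hab hw h1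
  have r2 := cf_R2 α β w hα hβ hab hw
  have s1 : Summable (fun n : ℕ => |cfA n / (w - (n : ℝ) ^ 2 * β)|) := r1.summable.abs
  have s2 : Summable (fun n : ℕ => |cfA n / (w + (n : ℝ) ^ 2 * α)|) := r2.summable.abs
  have s12 : Summable (fun p : ℕ × ℕ => cfA p.1 / (w - (p.1 : ℝ) ^ 2 * β) *
      (cfA p.2 / (w + (p.2 : ℝ) ^ 2 * α))) :=
    summable_mul_of_summable_norm (f := fun n : ℕ => cfA n / (w - (n : ℝ) ^ 2 * β))
      (g := fun n : ℕ => cfA n / (w + (n : ℝ) ^ 2 * α)) s1 s2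
  have S := HasSum.mul r1 r2 s12
  obtain ⟨G1, g1, g1'⟩ := cfG_hasSum α β hα hβ hab (fun n => w - (n : ℝ) ^ 2 * β) s1
  obtain ⟨G2, g2, g2'⟩ := cfG_hasSum β α hβ hα hba (fun n => w + (n : ℝ) ^ 2 * α) s2
  have g2s : HasSum (fun p : ℕ × ℕ => cfG β α (fun n => w + (n : ℝ) ^ 2 * α) (p.2, p.1)) G2 :=
    cf_swap g2
  have δ : HasSum (fun p : ℕ × ℕ => if p = (0, 0) then 1 / w ^ 2 else 0) (1 / w ^ 2) :=
    hasSum_ite_eq (0, 0) (1 / w ^ 2)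
  have k := ((((S.sub g1).add g2s).sub δ).mul_left w).tsum_eq
  have kk := fun p => cf_kk α β w hα hβ hw h2 p
  rw [tsum_congr kk] at k
  have t := (((g1'.sub g2').mul_left (w / 2)).sub (cfU_summable β hβ).hasSum).add
    (cfU_summable α hα).hasSum
  have tt := cf_congr t (fun n => cf_tt α β w hα hβ hw h2 n) rfl
  rw [tt.tsum_eq, k]
  have hsin : sin (√(w * α)) ≠ 0 := by
    rw [sin_ne_zero_iff]
    exact fun n h => h1 n h.symm
  have hsinh : 0 < sinh (√(w * β)) := sinh_pos_iff.2 (by positivity)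
  have hq : √(w * α) * √(w * β) = w * π := by
    rw [← sqrt_mul (by positivity), show w * α * (w * β) = (w * π) ^ 2 by rw [mul_pow, ← hab]; ring]
    exact sqrt_sq (by positivity)
  have : π ^ 2 / (β * √(w * α) * sin √(w * α)) * (π ^ 2 / (α * √(w * β) * sinh √(w * β)))
      = π / (w * sin √(w * α) * sinh √(w * β)) := by
    rw [div_mul_div_comm, show β * √(w * α) * sin √(w * α) * (α * √(w * β) * sinh √(w * β))
      = (α * β) * (√(w * α) * √(w * β)) * (sin √(w * α) * sinh √(w * β)) by ring, hab, hq]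
    field_simp
  rw [this]
  have e : π / (2 * sin √(w * α) * sinh √(w * β))
      = w / 2 * (π / (w * sin √(w * α) * sinh √(w * β))) := by
    have h3 := hsinh.ne'
    field_simp
  rw [e]
  generalize π / (w * sin √(w * α) * sinh √(w * β)) = Q
  generalize ∑' n, cfU β n = U1
  generalize ∑' n, cfU α n = U2
  have e2 : w * (1 / w ^ 2) = 1 / w := by field_simp
  have e3 : 1 / (2 * w) = (1 / w) / 2 := by field_simp
  rw [e3, ← e2]
  ring

lemma cf_lower (β : ℝ) (hβ : 0 < β) (k n : ℕ) :
    ((n:ℝ) + 1) * β / 2 ≤ |((k:ℝ) + 1 / 2) ^ 2 * β - ((n:ℝ) + 1) ^ 2 * β| := by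
  have : ((k:ℝ) + 1 / 2) ^ 2 * β - ((n:ℝ) + 1) ^ 2 * β = ((k:ℝ) - n - 1 / 2) * (((k:ℝ) + n + 3 / 2) * β) := by ring
  rw [this, abs_mul, abs_of_pos (by positivity : 0 < ((k:ℝ) + n + 3 / 2) * β)]
  have h : 1 / 2 ≤ |(k:ℝ) - n - 1 / 2| := by
    rw [le_abs]
    rcases le_or_gt k n with h | h
    · right
      have : (k:ℝ) ≤ n := by exact_mod_cast h
      linarith
    · left
      have : (n:ℝ) + 1 ≤ k := by exact_mod_cast h
      linarith
  have hk : (0:ℝ) ≤ k := by positivity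
  calc ((n:ℝ) + 1) * β / 2 = 1 / 2 * (((n:ℝ) + 1) * β) := by ring
    _ ≤ _ := by gcongr <;> linarith

open Filter Topology in
lemma cf_lim (α β : ℝ) (hα : 0 < α) (hβ : 0 < β) :
    Tendsto (fun k : ℕ => ∑' n, cfT α β (((k:ℝ) + 1 / 2) ^ 2 * β) n) atTop (𝓝 0) := by
  have hw : Tendsto (fun k : ℕ => ((k:ℝ) + 1 / 2) ^ 2 * β) atTop atTop := by
    apply Tendsto.atTop_mul_const hβ
    exact (tendsto_pow_atTop two_ne_zero).comp
      (tendsto_atTop_add_const_right _ _ tendsto_natCast_atTop_atTop)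
  have z : (0:ℝ) = ∑' n : ℕ, (0:ℝ) := by simp
  rw [z]
  refine tendsto_tsum_of_dominated_convergence (bound := fun n : ℕ => (1 / α + 8 / β ^ 2) / ((n:ℝ) + 1) ^ 2)
    (cf_summ_sq _) (fun n => ?_) (Eventually.of_forall fun k n => ?_)
  · have a1 : Tendsto (fun k : ℕ => ((k:ℝ) + 1 / 2) ^ 2 * β + ((n:ℝ) + 1) ^ 2 * α) atTop atTop :=
      tendsto_atTop_add_const_right _ _ hw
    have a2 : Tendsto (fun k : ℕ => ((k:ℝ) + 1 / 2) ^ 2 * β - ((n:ℝ) + 1) ^ 2 * β) atTop atTop := by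
      simpa [sub_eq_add_neg] using tendsto_atTop_add_const_right _ (-(((n:ℝ) + 1) ^ 2 * β)) hw
    have b1 := a1.const_mul_atTop (sinh_pos_iff.2 (by positivity : 0 < ((n : ℝ) + 1) * α))
    have b2 := a2.const_mul_atTop (sinh_pos_iff.2 (by positivity : 0 < ((n : ℝ) + 1) * β))
    have := (b1.const_div_atTop (((n : ℝ) + 1) * α * (-1 : ℝ) ^ (n + 1))).add
      (b2.const_div_atTop (((n : ℝ) + 1) * β * (-1 : ℝ) ^ (n + 1)))
    rw [add_zero] at this
    exact this
  · have p1 : 0 < sinh (((n : ℝ) + 1) * α) := sinh_pos_iff.2 (by positivity)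
    have p2 : 0 < sinh (((n : ℝ) + 1) * β) := sinh_pos_iff.2 (by positivity)
    have q1 : ((n:ℝ) + 1) * α ≤ sinh (((n : ℝ) + 1) * α) := self_le_sinh_iff.2 (by positivity)
    have q2 := cf_sinh_ge (((n:ℝ) + 1) * β) (by positivity)
    have q3 := cf_lower β hβ k n
    rw [cfT, add_div]
    refine (norm_add_le _ _).trans (add_le_add ?_ ?_)
    · rw [norm_div, norm_mul, norm_pow, norm_neg, norm_one, one_pow, mul_one, norm_eq_abs,
        norm_eq_abs, abs_of_pos (by positivity), abs_of_pos (by positivity)]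
      calc ((n:ℝ) + 1) * α / (sinh (((n:ℝ) + 1) * α) * (((k:ℝ) + 1 / 2) ^ 2 * β + ((n:ℝ) + 1) ^ 2 * α))
          ≤ ((n:ℝ) + 1) * α / ((((n:ℝ) + 1) * α) * (0 + ((n:ℝ) + 1) ^ 2 * α)) := by
            gcongr
            positivity
        _ = _ := by field_simp; simp
    · rw [norm_div, norm_mul, norm_pow, norm_neg, norm_one, one_pow, mul_one, norm_eq_abs,
        norm_eq_abs, abs_mul (sinh _), abs_of_pos (by positivity : 0 < ((n:ℝ) + 1) * β), abs_of_pos p2]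
      calc ((n:ℝ) + 1) * β / (sinh (((n:ℝ) + 1) * β) * |((k:ℝ) + 1 / 2) ^ 2 * β - ((n:ℝ) + 1) ^ 2 * β|)
          ≤ ((n:ℝ) + 1) * β / ((((n:ℝ) + 1) * β) ^ 2 / 4 * (((n:ℝ) + 1) * β / 2)) := by
            gcongr
        _ = _ := by field_simp; norm_num

open Filter Topology in
lemma cf_final (α β w : ℝ) (hα : 0 < α) (hβ : 0 < β)
    (hab : α * β = Real.pi ^ 2) (hw : 0 < w)
    (h1 : ∀ n : ℤ, Real.sqrt (w * α) ≠ (n : ℝ) * Real.pi)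
    (h2 : ∀ n : ℕ, 0 < n → w ≠ (n : ℝ) ^ 2 * β) :
    Real.pi / (2 * Real.sin (Real.sqrt (w * α)) * Real.sinh (Real.sqrt (w * β)))
      = 1 / (2 * w) + ∑' n : ℕ, cfT α β w n := by
  obtain ⟨D, hD⟩ := cf_main α β hα hβ hab
  suffices D = 0 by rw [hD w hw h1 h2, this, add_zero]
  have hp := pi_pos
  have hW : Tendsto (fun k : ℕ => ((k:ℝ) + 1 / 2) * β) atTop atTop := by
    apply Tendsto.atTop_mul_const hβ
    exact tendsto_atTop_add_const_right _ _ tendsto_natCast_atTop_atTop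
  have hW2 : Tendsto (fun k : ℕ => 2 * (((k:ℝ) + 1 / 2) ^ 2 * β)) atTop atTop := by
    apply Tendsto.const_mul_atTop two_pos
    apply Tendsto.atTop_mul_const hβ
    exact (tendsto_pow_atTop two_ne_zero).comp
      (tendsto_atTop_add_const_right _ _ tendsto_natCast_atTop_atTop)
  have hS : Tendsto (fun k : ℕ => sinh (((k:ℝ) + 1 / 2) * β)) atTop atTop :=
    tendsto_atTop_mono (fun k => self_le_sinh_iff.2 (by positivity)) hW
  have L : Tendsto (fun k : ℕ => π / 2 / sinh (((k:ℝ) + 1 / 2) * β)) atTop (𝓝 0) :=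
    hS.const_div_atTop _
  have R := ((hW2.const_div_atTop 1).add (cf_lim α β hα hβ)).add_const D
  have R' : Tendsto (fun k : ℕ => |1 / (2 * (((k:ℝ) + 1 / 2) ^ 2 * β)) +
      ∑' n, cfT α β (((k:ℝ) + 1 / 2) ^ 2 * β) n + D|) atTop (𝓝 |D|) := by
    simpa using R.abs
  have := tendsto_nhds_unique (R'.congr fun k => ?_) L
  · simpa using this
  · have e1 : √(((k:ℝ) + 1 / 2) ^ 2 * β * α) = (k + 1 / 2) * π := by
      rw [show ((k:ℝ) + 1 / 2) ^ 2 * β * α = ((k + 1 / 2) * π) ^ 2 by rw [mul_pow, ← hab]; ring]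
      exact sqrt_sq (by positivity)
    have e2 : √(((k:ℝ) + 1 / 2) ^ 2 * β * β) = (k + 1 / 2) * β := by
      rw [show ((k:ℝ) + 1 / 2) ^ 2 * β * β = ((k + 1 / 2) * β) ^ 2 by ring]
      exact sqrt_sq (by positivity)
    rw [← hD (((k:ℝ) + 1 / 2) ^ 2 * β) (by positivity)]
    · rw [e1, e2]
      have e3 : sin (((k:ℝ) + 1 / 2) * π) = (-1) ^ k := by
        rw [show ((k:ℝ) + 1 / 2) * π = π / 2 + k * π by ring, sin_add_nat_mul_pi]
        simp
      have p : 0 < sinh (((k:ℝ) + 1 / 2) * β) := sinh_pos_iff.2 (by positivity)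
      rw [e3, abs_div, abs_mul, abs_mul, abs_pow, abs_of_pos hp, abs_of_pos p]
      simp
      field_simp
    · intro n h
      rw [e1] at h
      have h := mul_right_cancel₀ hp.ne' h
      have : (2 * k + 1 : ℝ) = 2 * n := by linarith
      have : (2 * k + 1 : ℤ) = 2 * n := by exact_mod_cast this
      omega
    · intro n hn h
      obtain ⟨m, rfl⟩ := Nat.exists_eq_succ_of_ne_zero hn.ne'
      have := cf_lower β hβ k m
      push_cast at h
      rw [h, sub_self, abs_zero] at this
      have : 0 < ((m:ℝ) + 1) * β / 2 := by positivity
      linarith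




theorem csc_csch_partial_fraction (α β w : ℝ) (hα : 0 < α) (hβ : 0 < β)
    (hab : α * β = Real.pi ^ 2) (hw : 0 < w)
    (h1 : ∀ n : ℤ, Real.sqrt (w * α) ≠ (n : ℝ) * Real.pi)
    (h2 : ∀ n : ℕ, 0 < n → w ≠ (n : ℝ) ^ 2 * β) :
    Real.pi / (2 * Real.sin (Real.sqrt (w * α)) * Real.sinh (Real.sqrt (w * β)))
      = 1 / (2 * w)
        + ∑' n : ℕ,
            (((n : ℝ) + 1) * α * (-1 : ℝ) ^ (n + 1)
                / (Real.sinh (((n : ℝ) + 1) * α) * (w + ((n : ℝ) + 1) ^ 2 * α))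
              + ((n : ℝ) + 1) * β * (-1 : ℝ) ^ (n + 1)
                / (Real.sinh (((n : ℝ) + 1) * β) * (w - ((n : ℝ) + 1) ^ 2 * β))) := by
  exact cf_final α β w hα hβ hab hw h1 h2
end

section
/- For positive reals α, β with αβ = π², the identity Σ_{n=1}^∞ 1/(n(e^{2nα}-1)) - (1/4) log α + α/12 = Σ_{n=1}^∞ 1/(n(e^{2nβ}-1)) - (1/4) log β + β/12 holds. -/
open Real

lemma aux_summable {q : ℝ} (h0 : 0 < q) (h1 : q < 1) :
    Summable (fun p : ℕ × ℕ => q ^ ((p.1 + 1) * (p.2 + 1)) / ((p.2 : ℝ) + 1)) := by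
  have hg := summable_geometric_of_lt_one h0.le h1
  have hs : Summable (fun p : ℕ × ℕ => q ^ p.1 * q ^ p.2) :=
    hg.mul_of_nonneg hg (fun n => by positivity) (fun n => by positivity)
  refine Summable.of_nonneg_of_le (fun p => by positivity) (fun p => ?_) hs
  rw [← pow_add]
  calc q ^ ((p.1 + 1) * (p.2 + 1)) / ((p.2 : ℝ) + 1) ≤ q ^ ((p.1 + 1) * (p.2 + 1)) := by
        apply div_le_self (by positivity)
        have : (0 : ℝ) ≤ p.2 := by positivity
        linarith
    _ ≤ q ^ (p.1 + p.2) := pow_le_pow_of_le_one h0.le h1.le (by nlinarith)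

lemma aux_log {q : ℝ} (h0 : 0 < q) (h1 : q < 1) :
    (∑' n : ℕ, q ^ (n + 1) / (((n : ℝ) + 1) * (1 - q ^ (n + 1))))
      = - ∑' m : ℕ, Real.log (1 - q ^ (m + 1)) := by
  have hs := aux_summable h0 h1
  have hlt : ∀ n : ℕ, q ^ (n + 1) < 1 := fun n => pow_lt_one₀ h0.le h1 (by omega)
  rw [← tsum_neg]
  have e1 : ∀ m : ℕ, - Real.log (1 - q ^ (m + 1))
      = ∑' n : ℕ, q ^ ((m + 1) * (n + 1)) / ((n : ℝ) + 1) := by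
    intro m
    have h := Real.hasSum_pow_div_log_of_abs_lt_one (x := q ^ (m + 1))
      (by rw [abs_of_pos (by positivity)]; exact hlt m)
    rw [← h.tsum_eq]
    simp only [pow_mul]
  have e2 : ∀ n : ℕ, q ^ (n + 1) / (((n : ℝ) + 1) * (1 - q ^ (n + 1)))
      = ∑' m : ℕ, q ^ ((m + 1) * (n + 1)) / ((n : ℝ) + 1) := by
    intro n
    have h := (hasSum_geometric_of_lt_one (pow_pos h0 (n + 1)).le (hlt n)).mul_left
      (q ^ (n + 1) / ((n : ℝ) + 1))
    have h3 : (1 - q ^ (n + 1)) ≠ 0 := by linarith [hlt n]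
    have h4 : (n : ℝ) + 1 ≠ 0 := by positivity
    convert! h.tsum_eq.symm using 1
    · field_simp
    · congr 1; ext m
      rw [mul_comm (m + 1), pow_mul, pow_succ]; ring
  simp_rw [e1, e2]
  exact hs.tsum_comm

lemma aux_eta {a : ℝ} (ha : 0 < a) :
    ModularForm.eta ((a / π : ℝ) * Complex.I) =
      ((Real.exp (-((∑' n : ℕ, 1 / (((n : ℝ) + 1) * (Real.exp (2 * ((n : ℝ) + 1) * a) - 1)))
        + a / 12)) : ℝ) : ℂ) := by
  set q : ℝ := Real.exp (-(2 * a)) with hq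
  have h0 : 0 < q := Real.exp_pos _
  have h1 : q < 1 := by rw [hq, Real.exp_lt_one_iff]; linarith
  have hlt : ∀ n : ℕ, q ^ (n + 1) < 1 := fun n => pow_lt_one₀ h0.le h1 (by omega)
  have hsum : (∑' n : ℕ, 1 / (((n : ℝ) + 1) * (Real.exp (2 * ((n : ℝ) + 1) * a) - 1)))
      = ∑' n : ℕ, q ^ (n + 1) / (((n : ℝ) + 1) * (1 - q ^ (n + 1))) := by
    congr 1; ext n
    have : Real.exp (2 * ((n : ℝ) + 1) * a) = (q ^ (n + 1))⁻¹ := by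
      rw [hq, ← Real.exp_nat_mul, ← Real.exp_neg]; congr 1; push_cast; ring
    rw [this]
    have h3 : (1 - q ^ (n + 1)) ≠ 0 := by linarith [hlt n]
    have h4 : (n : ℝ) + 1 ≠ 0 := by positivity
    have h5 : q ^ (n + 1) ≠ 0 := by positivity
    have h6 : (q ^ (n + 1))⁻¹ - 1 = (1 - q ^ (n + 1)) / q ^ (n + 1) := by field_simp
    rw [h6]
    field_simp
  have hsl : Summable fun n : ℕ => Real.log (1 - q ^ (n + 1)) := by
    have := Real.summable_log_one_add_of_summable (f := fun n : ℕ => - q ^ (n + 1))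
      (((summable_nat_add_iff 1).mpr (summable_geometric_of_lt_one h0.le h1)).neg)
    simpa [sub_eq_add_neg] using this
  have hp := Real.hasProd_of_hasSum_log (f := fun n : ℕ => 1 - q ^ (n + 1))
    (fun n => by linarith [hlt n]) hsl.hasSum
  have hpc := hp.map Complex.ofRealHom Complex.continuous_ofReal
  have hpi : (π : ℂ) ≠ 0 := by exact_mod_cast Real.pi_ne_zero
  have hprod : ∏' n, (1 - ModularForm.eta_q n ((a / π : ℝ) * Complex.I))
      = ((Real.exp (∑' n : ℕ, Real.log (1 - q ^ (n + 1))) : ℝ) : ℂ) := by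
    refine Eq.trans ?_ hpc.tprod_eq
    congr 1; ext n
    have : Complex.exp (2 * π * Complex.I * ((a / π : ℝ) * Complex.I)) = (q : ℂ) := by
      rw [hq, Complex.ofReal_exp]; congr 1
      push_cast
      field_simp
      rw [Complex.I_sq]; ring
    rw [ModularForm.eta_q_eq_pow, this]
    simp
  rw [ModularForm.eta, hprod, hsum, aux_log h0 h1, neg_add, neg_neg, Real.exp_add, mul_comm,
    Complex.ofReal_mul]
  congr 1
  rw [Complex.ofReal_exp, Function.Periodic.qParam]
  congr 1
  push_cast
  field_simp
  rw [Complex.I_sq]; ring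

theorem dedekind_eta_type_identity (α β : ℝ) (hα : 0 < α) (hβ : 0 < β)
    (hab : α * β = Real.pi ^ 2) :
    (∑' n : ℕ, 1 / (((n : ℝ) + 1) * (Real.exp (2 * ((n : ℝ) + 1) * α) - 1)))
        - 1 / 4 * Real.log α + α / 12
      = (∑' n : ℕ, 1 / (((n : ℝ) + 1) * (Real.exp (2 * ((n : ℝ) + 1) * β) - 1)))
        - 1 / 4 * Real.log β + β / 12 := by
  have hπ := Real.pi_pos
  have hz : ((α / π : ℝ) * Complex.I) ∈ UpperHalfPlane.upperHalfPlaneSet := by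
    show 0 < ((α / π : ℝ) * Complex.I).im
    simp only [Complex.im_ofReal_mul, Complex.I_im]
    positivity
  have hα' : (α : ℂ) ≠ 0 := by exact_mod_cast hα.ne'
  have hpi : (π : ℂ) ≠ 0 := by exact_mod_cast Real.pi_ne_zero
  have h := ModularForm.eta_comp_eq_csqrt_I_inv hz
  simp only [Function.comp_apply, Pi.smul_apply, Pi.mul_apply, smul_eq_mul] at h
  have hinv : -1 / ((α / π : ℝ) * Complex.I) = ((β / π : ℝ) * Complex.I) := by
    have hab' : (α : ℂ) * β = π ^ 2 := by exact_mod_cast hab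
    rw [div_eq_iff (mul_ne_zero (by exact_mod_cast (div_pos hα hπ).ne') Complex.I_ne_zero)]
    push_cast
    field_simp
    rw [Complex.I_sq]
    linear_combination hab'
  rw [hinv, aux_eta hα, aux_eta hβ] at h
  have hs : ∀ z : ℂ, z ≠ 0 → ‖Complex.sqrt z‖ = Real.exp (Real.log ‖z‖ / 2) := by
    intro z hz
    rw [Complex.sqrt, Complex.cpow_def_of_ne_zero hz, Complex.norm_exp]
    congr 1
    have h2 : (2⁻¹ : ℂ) = ((2⁻¹ : ℝ) : ℂ) := by push_cast; rfl
    rw [h2, Complex.re_mul_ofReal, Complex.log_re]; ring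
  have hn := congrArg (fun z => Real.log ‖z‖) h
  simp only [norm_mul, norm_inv, hs _ Complex.I_ne_zero,
    hs _ (mul_ne_zero (by exact_mod_cast (div_pos hα hπ).ne' : ((α / π : ℝ) : ℂ) ≠ 0)
      Complex.I_ne_zero), Complex.norm_real, Complex.norm_I, Real.norm_eq_abs, Real.abs_exp,
      abs_of_pos (div_pos hα hπ), Real.log_one, mul_one, zero_div, Real.exp_zero, inv_one, one_mul,
      ← Real.exp_add, Real.log_exp] at hn
  rw [Real.log_div hα.ne' hπ.ne'] at hn
  have hl := congrArg Real.log hab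
  rw [Real.log_mul hα.ne' hβ.ne', Real.log_pow] at hl
  push_cast at hl
  linarith
end

section
/- For positive reals α, β with αβ = π², the identity Σ_{n=1}^∞ ((-1)^n/n)(1/sinh(nβ) - 1/sinh(nα)) = (β - α)/12 holds. -/
open Real
noncomputable def Lam (x : ℝ) (n : ℕ) : ℝ := 1 / ((n:ℝ)+1) * (rexp (-(((n:ℝ)+1)*x)) / (1 - rexp (-(((n:ℝ)+1)*x))))

lemma FF (x : ℝ) (hx : 0 < x) : Summable (fun p : ℕ × ℕ => (rexp (-(((p.1:ℝ)+1)*x)))^(p.2+1) / ((p.2:ℝ)+1)) := by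
  have hr : rexp (-x) < 1 := by simpa using hx
  have h0 := summable_geometric_of_lt_one (exp_pos (-x)).le hr
  refine Summable.of_nonneg_of_le (fun p => by positivity) (fun p => ?_) (h0.mul_of_nonneg h0 (fun n => by positivity) (fun n => by positivity))
  rw [← pow_add]
  refine (div_le_self (by positivity) (by linarith [(Nat.cast_nonneg p.2 : (0:ℝ) ≤ _)])).trans ?_
  have : rexp (-(((p.1:ℝ)+1)*x)) = rexp (-x) ^ (p.1+1) := by
    rw [← Real.exp_nat_mul]; push_cast; ring_nf
  rw [this, ← pow_mul]
  exact pow_le_pow_of_le_one (exp_pos _).le hr.le (by nlinarith)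

lemma rlt (x : ℝ) (hx : 0 < x) (n : ℕ) : rexp (-(((n:ℝ)+1)*x)) < 1 := by
  rw [Real.exp_lt_one_iff]; have : 0 < ((n:ℝ)+1)*x := by positivity
  linarith

lemma hasSum_log (x : ℝ) (hx : 0 < x) (k : ℕ) :
   HasSum (fun m : ℕ => (rexp (-(((k:ℝ)+1)*x)))^(m+1) / ((m:ℝ)+1)) (-log (1 - rexp (-(((k:ℝ)+1)*x)))) := by
  apply Real.hasSum_pow_div_log_of_abs_lt_one
  rw [abs_of_pos (exp_pos _)]; exact rlt x hx k

lemma hasSum_geo (x : ℝ) (hx : 0 < x) (m : ℕ) :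
   HasSum (fun k : ℕ => (rexp (-(((k:ℝ)+1)*x)))^(m+1) / ((m:ℝ)+1)) (Lam x m) := by
  have h := (hasSum_geometric_of_lt_one (exp_pos _).le (rlt x hx m)).mul_left (1 / ((m:ℝ)+1) * rexp (-(((m:ℝ)+1)*x)))
  convert! h using 1
  · ext k
    have : rexp (-(((k:ℝ)+1)*x)) ^ (m+1) = rexp (-(((m:ℝ)+1)*x)) * rexp (-(((m:ℝ)+1)*x))^k := by
      rw [← Real.exp_nat_mul, ← Real.exp_nat_mul, ← Real.exp_add]; push_cast; ring_nf
    rw [this]; ring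
  · rw [Lam]; ring

lemma sumLam (x : ℝ) (hx : 0 < x) : Summable (Lam x) := by
  have h := (FF x hx).prod_symm.prod
  refine h.congr (fun m => ?_)
  exact (hasSum_geo x hx m).tsum_eq

lemma sumlog (x : ℝ) (hx : 0 < x) : Summable (fun k : ℕ => log (1 - rexp (-(((k:ℝ)+1)*x)))) := by
  have h := (FF x hx).prod.neg
  refine h.congr (fun k => ?_)
  simp only [(hasSum_log x hx k).tsum_eq, neg_neg]

lemma tsumLam (x : ℝ) (hx : 0 < x) : ∑' k : ℕ, log (1 - rexp (-(((k:ℝ)+1)*x))) = - ∑' n, Lam x n := by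
  have h := (FF x hx).tsum_comm (f := fun k m : ℕ => (rexp (-(((k:ℝ)+1)*x)))^(m+1) / ((m:ℝ)+1))
  simp only [(hasSum_log x hx _).tsum_eq, (hasSum_geo x hx _).tsum_eq, tsum_neg] at h
  linarith

lemma normEta (x : ℝ) (hx : 0 < x) :
    ‖ModularForm.eta (Complex.I * (x / (2 * π) : ℝ))‖ = rexp (-x/24 - ∑' n, Lam x n) := by
  have hq : Function.Periodic.qParam 1 (Complex.I * (x / (2 * π) : ℝ)) = (rexp (-x) : ℝ) := by
    rw [Function.Periodic.qParam]; push_cast; congr 1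
    field_simp; simp
  have hq' : Function.Periodic.qParam 24 (Complex.I * (x / (2 * π) : ℝ)) = (rexp (-x/24) : ℝ) := by
    rw [Function.Periodic.qParam]; push_cast; congr 1
    field_simp; simp
  rw [ModularForm.eta, norm_mul, hq', sub_eq_add_neg, Real.exp_add, ← tsumLam x hx,
    Real.rexp_tsum_eq_tprod (fun i => by linarith [rlt x hx i]) (sumlog x hx)]
  have hm : Multipliable fun n : ℕ ↦ 1 - ((rexp (-x) : ℝ) : ℂ) ^ (n + 1) :=
    ModularForm.multipliable_one_sub_pow (by
      rw [Complex.norm_real, Real.norm_eq_abs, abs_of_pos (exp_pos _)]; simpa using hx)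
  congr 1
  · rw [Complex.norm_real, Real.norm_eq_abs, abs_of_pos (exp_pos _)]
  · simp only [ModularForm.eta_q, hq]
    rw [hm.norm_tprod]
    congr 1; ext n
    have h1 : rexp (-(((n:ℝ)+1)*x)) = rexp (-x) ^ (n+1) := by
      rw [← Real.exp_nat_mul]; push_cast; ring_nf
    have h2 := rlt x hx n
    rw [h1] at h2 ⊢
    rw [← Complex.ofReal_pow, ← Complex.ofReal_one, ← Complex.ofReal_sub, Complex.norm_real, Real.norm_eq_abs, abs_of_pos (by linarith)]

lemma normSqrt (z : ℂ) : ‖Complex.sqrt z‖ ^ 2 = ‖z‖ := by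
  rw [← norm_pow]; congr 1
  simp [Complex.sqrt]

lemma trans_L (x y : ℝ) (hx : 0 < x) (hy : 0 < y) (hxy : x * y = 4 * π^2) :
    ∑' n, Lam y n = ∑' n, Lam x n + x/24 - y/24 - log (x/(2*π)) / 2 := by
  have hp := Real.pi_pos
  have him : (Complex.I * (x / (2 * π) : ℝ)) ∈ UpperHalfPlane.upperHalfPlaneSet := by
    show 0 < Complex.im _
    rw [Complex.im_mul_ofReal]; simp; positivity
  have h := ModularForm.eta_comp_eq_csqrt_I_inv him
  have he : -1 / (Complex.I * (x / (2 * π) : ℝ)) = Complex.I * (y / (2 * π) : ℝ) := by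
    have hx0 : (x:ℂ) ≠ 0 := by exact_mod_cast hx.ne'
    have hp0 : (π:ℂ) ≠ 0 := by exact_mod_cast hp.ne'
    have : (x:ℂ) * y = 4 * π^2 := by exact_mod_cast hxy
    push_cast
    field_simp
    rw [Complex.I_sq]; linear_combination this
  simp only [Function.comp, he, Pi.smul_apply, Pi.mul_apply, smul_eq_mul] at h
  have h2 := congrArg (fun z => ‖z‖^2) h
  simp only [norm_mul, norm_inv, mul_pow, inv_pow, normSqrt, normEta x hx, normEta y hy] at h2
  have hpos : 0 < x/(2*π) := by positivity
  rw [Complex.norm_I, Complex.norm_real, Real.norm_eq_abs, abs_of_pos hpos] at h2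
  have h3 := congrArg Real.log h2
  rw [inv_one, one_mul, one_mul, Real.log_mul hpos.ne' (by positivity), Real.log_pow, Real.log_pow, Real.log_exp, Real.log_exp] at h3
  push_cast at h3
  linarith

lemma csch (x : ℝ) (hx : 0 < x) (n : ℕ) : 1 / ((n:ℝ)+1) * (1 / sinh (((n:ℝ)+1)*x)) = 2 * (Lam x n - Lam (2*x) n) := by
  have h1 := rlt x hx n
  have e : rexp (-(((n:ℝ)+1)*(2*x))) = rexp (-(((n:ℝ)+1)*x))^2 := by
    rw [← Real.exp_nat_mul]; push_cast; ring_nf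
  rw [Lam, Lam, e, Real.sinh_eq, Real.exp_neg] 
  rw [Real.exp_neg] at h1
  set E := rexp (((n:ℝ)+1)*x)
  have hE : 1 < E := by
    have := (Real.one_lt_exp_iff (x := ((n:ℝ)+1)*x)).2 (by positivity)
    exact this
  have a1 : E - 1 ≠ 0 := by linarith
  have a2 : E^2 - 1 ≠ 0 := by nlinarith
  have a0 : E ≠ 0 := by linarith
  have r1 : 1 / ((E - E⁻¹)/2) = 2*E/(E^2-1) := by field_simp
  have r2 : E⁻¹ / (1 - E⁻¹) = 1/(E-1) := by field_simp
  have r3 : E⁻¹^2 / (1 - E⁻¹^2) = 1/(E^2-1) := by field_simp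
  have r4 : 1/(E-1) = (E+1)/(E^2-1) := by rw [div_eq_div_iff a1 a2]; ring
  rw [r1, r2, r3, r4]; ring

lemma hasS (x : ℝ) (hx : 0 < x) : HasSum (fun n : ℕ => ((-1:ℝ)^(n+1) / ((n:ℝ)+1)) * (1 / sinh (((n:ℝ)+1)*x)))
   (-2 * ∑' n, Lam x n + 4 * ∑' n, Lam (2*x) n - 2 * ∑' n, Lam (4*x) n) := by
  have A := (sumLam x hx).hasSum
  have B := (sumLam (2*x) (by positivity)).hasSum
  have C := (sumLam (4*x) (by positivity)).hasSum
  have D := (A.sub B).mul_left 2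
  have D2 := (B.sub C).mul_left 2
  set G : ℕ → ℝ := fun n => 1 / ((n:ℝ)+1) * (1 / sinh (((n:ℝ)+1)*x))
  have hG : G = fun n => 2 * (Lam x n - Lam (2*x) n) := funext (csch x hx)
  have hGs := D
  rw [← hG] at hGs
  -- odd-index part
  set O : ℕ → ℝ := fun n => if n % 2 = 1 then 2 * G n else 0
  have hO : HasSum O (0 + 2 * (∑' n, Lam (2*x) n - ∑' n, Lam (4*x) n)) := by
    refine HasSum.even_add_odd ?_ ?_
    · convert! hasSum_zero using 2 with k
      simp [O]
    · convert! D2 using 2 with k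
      have : (2*k+1)%2 = 1 := by omega
      simp only [O, this, if_true]
      have := csch (2*x) (by positivity) k
      rw [show 2*(2*x) = 4*x by ring] at this
      rw [← this]
      simp only [G]; push_cast
      rw [show (2*(k:ℝ)+1+1) = 2 * ((k:ℝ)+1) by ring, show 2 * ((k:ℝ)+1) * x = ((k:ℝ)+1)*(2*x) by ring]
      field_simp
  convert! hO.sub hGs using 1
  · ext n
    rcases Nat.even_or_odd n with h | h
    · have h' : n % 2 = 0 := Nat.even_iff.1 h
      simp only [O, G, h', pow_succ, h.neg_one_pow]; norm_num; try ring
    · have h' : n % 2 = 1 := Nat.odd_iff.1 h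
      simp only [O, G, h', pow_succ, h.neg_one_pow]; norm_num; try ring
  · ring

theorem alternating_csch_difference_identity (α β : ℝ) (hα : 0 < α) (hβ : 0 < β)
    (hab : α * β = Real.pi ^ 2) :
    ∑' n : ℕ, ((-1 : ℝ) ^ (n + 1) / ((n : ℝ) + 1))
        * (1 / Real.sinh (((n : ℝ) + 1) * β) - 1 / Real.sinh (((n : ℝ) + 1) * α))
      = (β - α) / 12 := by
  have h := (hasS β hβ).sub (hasS α hα)
  simp only [← mul_sub] at h
  rw [h.tsum_eq]
  have t1 := trans_L (4*α) β (by positivity) hβ (by linarith)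
  have t2 := trans_L (2*α) (2*β) (by positivity) (by positivity) (by linarith)
  have t3 := trans_L α (4*β) hα (by positivity) (by linarith)
  have hp := Real.pi_pos
  have l1 : log (4*α/(2*π)) = log 2 + log 2 + log (α/(2*π)) := by
    rw [← Real.log_mul (by norm_num) (by norm_num), ← Real.log_mul (by norm_num) (by positivity)]; congr 1; ring
  have l2 : log (2*α/(2*π)) = log 2 + log (α/(2*π)) := by
    rw [← Real.log_mul (by norm_num) (by positivity)]; congr 1; ring
  rw [l1] at t1
  rw [l2] at t2
  linarith
end
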